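/- Suppose Q is symmetric and copositive on D_∞ = { v : Dv ≥ 0 }. Then the value function qp_opt(q,b) = inf { qᵀz + ½zᵀQz : Dz ≥ b } is continuous on its domain of finiteness dom(Q,D) = { (q,b) : -∞ < qp_opt(q,b) < ∞ }; moreover, for a sequence (qᵛ, bᵛ) in dom(Q,D) converging to (q^∞, b^∞), the limit (q^∞, b^∞) also lies in dom(Q,D) and qp_opt(qᵛ,bᵛ) → qp_opt(q^∞,b^∞). -/

import Mathlib

open scoped Matrix

open Filter Topology

/-- The polyhedron `{z | D z ≥ b}`. -/
def polyhedron {m k : ℕ} (D : Matrix (Fin k) (Fin m) ℝ) (b : Fin k → ℝ) : Set (Fin m → ℝ) :=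
  {z | ∀ i, b i ≤ D.mulVec z i}

/-- The quadratic objective `qᵀz + ½ zᵀQz`. -/
noncomputable def quadObj {m : ℕ} (Q : Matrix (Fin m) (Fin m) ℝ) (q z : Fin m → ℝ) : ℝ :=
  q ⬝ᵥ z + (1 / 2) * z ⬝ᵥ Q.mulVec z

/-- The set of objective values of the quadratic program with data `(q, b)`. -/
def quadValues {m k : ℕ} (Q : Matrix (Fin m) (Fin m) ℝ) (D : Matrix (Fin k) (Fin m) ℝ)
    (q : Fin m → ℝ) (b : Fin k → ℝ) : Set ℝ :=
  {r | ∃ z, z ∈ polyhedron D b ∧ r = quadObj Q q z}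

section

variable {m k : ℕ} {Q : Matrix (Fin m) (Fin m) ℝ} {D : Matrix (Fin k) (Fin m) ℝ}

lemma continuous_mulVec_apply (i : Fin k) : Continuous fun z : Fin m → ℝ => D.mulVec z i := by
  unfold Matrix.mulVec dotProduct
  fun_prop

lemma isClosed_polyhedron (b : Fin k → ℝ) : IsClosed (polyhedron D b) := by
  simp only [polyhedron, Set.ofPred_forall]
  exact isClosed_iInter fun i => isClosed_le continuous_const (continuous_mulVec_apply i)

lemma continuous_quadObj :
    Continuous fun p : (Fin m → ℝ) × (Fin m → ℝ) => quadObj Q p.1 p.2 := by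
  unfold quadObj Matrix.mulVec dotProduct
  fun_prop

lemma tendsto_quadObj {ι : Type*} {F : Filter ι} {q z : ι → Fin m → ℝ} {q₀ z₀ : Fin m → ℝ}
    (hq : Tendsto q F (𝓝 q₀)) (hz : Tendsto z F (𝓝 z₀)) :
    Tendsto (fun n => quadObj Q (q n) (z n)) F (𝓝 (quadObj Q q₀ z₀)) :=
  (continuous_quadObj.tendsto (q₀, z₀)).comp (hq.prodMk_nhds hz)

lemma mem_polyhedron_of_tendsto {ι : Type*} {F : Filter ι} [F.NeBot] {b : ι → Fin k → ℝ}
    {z : ι → Fin m → ℝ} {b₀ : Fin k → ℝ} {z₀ : Fin m → ℝ}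
    (hb : Tendsto b F (𝓝 b₀)) (hz : Tendsto z F (𝓝 z₀))
    (h : ∀ n, z n ∈ polyhedron D (b n)) : z₀ ∈ polyhedron D b₀ := fun i =>
  le_of_tendsto_of_tendsto' (tendsto_pi_nhds.1 hb i)
    (((continuous_mulVec_apply i).tendsto z₀).comp hz) fun n => h n i

lemma quadObj_add_smul (hQ : Q.IsSymm) (q z v : Fin m → ℝ) (t : ℝ) :
    quadObj Q q (z + t • v) =
      quadObj Q q z + t * ((q + Q.mulVec z) ⬝ᵥ v) + (1 / 2) * t ^ 2 * v ⬝ᵥ Q.mulVec v := by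
  have h : z ⬝ᵥ Q.mulVec v = v ⬝ᵥ Q.mulVec z := by
    rw [Matrix.dotProduct_mulVec, ← Matrix.mulVec_transpose, hQ.eq, dotProduct_comm]
  simp only [quadObj, Matrix.mulVec_add, Matrix.mulVec_smul, dotProduct_add, add_dotProduct,
    dotProduct_smul, smul_dotProduct, smul_eq_mul, h, dotProduct_comm (Q.mulVec z) v]
  ring

lemma exists_norm_le_of_isClosed {S : Set (Fin m → ℝ)} (hS : IsClosed S) (hne : S.Nonempty) :
    ∃ z ∈ S, ∀ w ∈ S, ‖z‖ ≤ ‖w‖ := by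
  obtain ⟨z, hz, h⟩ := hS.exists_infDist_eq_dist hne 0
  refine ⟨z, hz, fun w hw => ?_⟩
  have := Metric.infDist_le_dist_of_mem (x := (0 : Fin m → ℝ)) hw
  rwa [h, dist_zero_left, dist_zero_left] at this

lemma exists_subseq_tendsto_normalized {z : ℕ → Fin m → ℝ} (hz : ∀ n, 0 < ‖z n‖) :
    ∃ v : Fin m → ℝ, ‖v‖ = 1 ∧ ∃ φ : ℕ → ℕ, StrictMono φ ∧
      Tendsto (fun n => ‖z (φ n)‖⁻¹ • z (φ n)) atTop (𝓝 v) := by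
  obtain ⟨v, hv, φ, hφ, h⟩ := (isCompact_sphere (0 : Fin m → ℝ) 1).tendsto_subseq
    (x := fun n => ‖z n‖⁻¹ • z n) fun n => by
      simp [norm_smul, inv_mul_cancel₀ (hz n).ne']
  exact ⟨v, by simpa using hv, φ, hφ, h⟩

/-- Moving from `z n` against the limit `v` of the normalized sequence preserves feasibility and
decreases the norm, provided the right-hand sides are negligible compared with `‖z n‖`. -/
lemma eventually_sub_smul_mem_polyhedron {z : ℕ → Fin m → ℝ} {c : ℕ → Fin k → ℝ}
    {e : ℕ → ℝ} {v : Fin m → ℝ} (hz : ∀ n, 0 < ‖z n‖) (hv : ‖v‖ = 1)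
    (hlim : Tendsto (fun n => ‖z n‖⁻¹ • z n) atTop (𝓝 v))
    (hfeas : ∀ n, z n ∈ polyhedron D (c n)) (he : Tendsto e atTop (𝓝 0))
    (hce : ∀ n i, c n i ≤ e n * ‖z n‖) :
    ∀ᶠ n in atTop, z n + (-(‖z n‖ / 2)) • v ∈ polyhedron D (c n) ∧
      ‖z n + (-(‖z n‖ / 2)) • v‖ < ‖z n‖ := by
  have key : ∀ n, z n + (-(‖z n‖ / 2)) • v = ‖z n‖ • (‖z n‖⁻¹ • z n - (1 / 2 : ℝ) • v) := by
    intro n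
    rw [smul_sub, smul_smul, mul_inv_cancel₀ (hz n).ne', one_smul, smul_smul, neg_smul,
      ← sub_eq_add_neg]
    ring_nf
  have hsub : Tendsto (fun n => ‖z n‖⁻¹ • z n - (1 / 2 : ℝ) • v) atTop
      (𝓝 ((1 / 2 : ℝ) • v)) := by
    have := hlim.sub_const ((1 / 2 : ℝ) • v)
    rwa [show v - (1 / 2 : ℝ) • v = (1 / 2 : ℝ) • v by
      rw [sub_eq_iff_eq_add, ← add_smul]; norm_num] at this
  refine (eventually_all.2 fun i => ?_).and ?_
  · rcases le_or_gt (D.mulVec v i) 0 with hi | hi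
    · refine Eventually.of_forall fun n => ?_
      have h1 := hfeas n i
      have h2 := mul_nonneg (hz n).le (neg_nonneg.2 hi)
      simp only [Matrix.mulVec_add, Matrix.mulVec_smul, Pi.add_apply, Pi.smul_apply, smul_eq_mul]
      linarith
    · have h1 := ((continuous_mulVec_apply (D := D) i).tendsto _).comp hsub
      have h2 : 0 < D.mulVec ((1 / 2 : ℝ) • v) i := by
        simp only [Matrix.mulVec_smul, Pi.smul_apply, smul_eq_mul]
        linarith
      filter_upwards [he.eventually_lt h1 h2] with n hn
      rw [key, Matrix.mulVec_smul, Pi.smul_apply, smul_eq_mul, mul_comm]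
      exact (hce n i).trans (mul_le_mul_of_nonneg_right hn.le (hz n).le)
  · have h1 := hsub.norm
    rw [norm_smul, hv] at h1
    filter_upwards [h1.eventually_lt_const (u := 1) (by norm_num)] with n hn
    rw [key, norm_smul, norm_norm]
    exact mul_lt_of_lt_one_right (hz n) hn

/-- The Hoffman bound: a feasible system `D y ≥ c` with `c ≤ s` has a solution of norm `O(s)`. -/
lemma exists_hoffman_bound (D : Matrix (Fin k) (Fin m) ℝ) :
    ∃ K : ℝ, ∀ (c : Fin k → ℝ) (s : ℝ), 0 ≤ s → (∀ i, c i ≤ s) → (polyhedron D c).Nonempty →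
      ∃ y ∈ polyhedron D c, ‖y‖ ≤ K * s := by
  by_contra! H
  choose c s hs hcs hne hbig using fun n : ℕ => H ((n : ℝ) + 1)
  choose y hy hmin using fun n => exists_norm_le_of_isClosed (isClosed_polyhedron (c n)) (hne n)
  have hylt : ∀ n : ℕ, ((n : ℝ) + 1) * s n < ‖y n‖ := fun n => hbig n _ (hy n)
  have hpos : ∀ n, 0 < ‖y n‖ := fun n =>
    (mul_nonneg (by positivity) (hs n)).trans_lt (hylt n)
  obtain ⟨v, hv, φ, hφ, hlim⟩ := exists_subseq_tendsto_normalized hpos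
  have := eventually_sub_smul_mem_polyhedron (D := D) (c := fun n => c (φ n))
    (e := fun n => 1 / ((φ n : ℝ) + 1)) (fun n => hpos (φ n)) hv hlim (fun n => hy (φ n))
    (tendsto_one_div_add_atTop_nhds_zero_nat.comp hφ.tendsto_atTop) (fun n i => by
      refine (hcs _ i).trans ?_
      rw [one_div, ← div_eq_inv_mul, le_div_iff₀ (by positivity), mul_comm]
      exact (hylt _).le)
  obtain ⟨n, h1, h2⟩ := this.exists
  exact absurd (hmin _ _ h1) (not_le.2 h2)

/-- A quadratic program that is bounded below has nonnegative slope along every recession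
direction of nonpositive curvature. -/
lemma slope_nonneg_of_bddBelow (hQ : Q.IsSymm) {q z v : Fin m → ℝ} {b : Fin k → ℝ}
    (hbdd : BddBelow (quadValues Q D q b)) (hz : z ∈ polyhedron D b)
    (hv : ∀ i, 0 ≤ D.mulVec v i) (hvv : v ⬝ᵥ Q.mulVec v ≤ 0) :
    0 ≤ (q + Q.mulVec z) ⬝ᵥ v := by
  obtain ⟨M, hM⟩ := hbdd
  by_contra! hg
  set g := (q + Q.mulVec z) ⬝ᵥ v with hgdef
  have hray : ∀ t : ℝ, 0 ≤ t → M ≤ quadObj Q q z + t * g := by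
    intro t ht
    have h1 : M ≤ quadObj Q q (z + t • v) := hM ⟨z + t • v, fun i => by
      have := hz i
      have := mul_nonneg ht (hv i)
      simp only [Matrix.mulVec_add, Matrix.mulVec_smul, Pi.add_apply, Pi.smul_apply, smul_eq_mul]
      linarith, rfl⟩
    rw [quadObj_add_smul hQ, ← hgdef] at h1
    have h2 := mul_nonneg (sq_nonneg t) (neg_nonneg.2 hvv)
    linarith
  have h0 := hray 0 le_rfl
  have h1 := hray ((quadObj Q q z - M + 1) / (-g)) (div_nonneg (by linarith) (by linarith))
  have h2 : (quadObj Q q z - M + 1) / (-g) * g = -(quadObj Q q z - M + 1) := by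
    rw [div_neg, neg_mul, div_mul_cancel₀ _ hg.ne]
  linarith

/-- A uniform Frank–Wolfe theorem: over bounded data for which the program is bounded below,
bounded sublevel sets contain points of bounded norm. -/
lemma exists_bounded_point_below (hQ : Q.IsSymm) (D : Matrix (Fin k) (Fin m) ℝ) (R : ℝ) :
    ∃ K : ℝ, ∀ (q : Fin m → ℝ) (b : Fin k → ℝ) (z₀ : Fin m → ℝ), ‖q‖ ≤ R → ‖b‖ ≤ R →
      BddBelow (quadValues Q D q b) → z₀ ∈ polyhedron D b → quadObj Q q z₀ ≤ R →
      ∃ z ∈ polyhedron D b, quadObj Q q z ≤ quadObj Q q z₀ ∧ ‖z‖ ≤ K := by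
  by_contra! H
  choose q b z₀ hq hb hbdd hz₀ hR hbig using fun n : ℕ => H ((n : ℝ) + 1)
  have hclosed : ∀ n, IsClosed
      (polyhedron D (b n) ∩ {z | quadObj Q (q n) z ≤ quadObj Q (q n) (z₀ n)}) := fun n =>
    (isClosed_polyhedron _).inter <| isClosed_le
      (continuous_quadObj.comp (continuous_const.prodMk continuous_id)) continuous_const
  choose z hz hmin using fun n => exists_norm_le_of_isClosed (hclosed n)
    ⟨z₀ n, hz₀ n, le_refl (quadObj Q (q n) (z₀ n))⟩
  have hle : ∀ n, quadObj Q (q n) (z n) ≤ quadObj Q (q n) (z₀ n) := fun n => (hz n).2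
  have hlt : ∀ n : ℕ, (n : ℝ) + 1 < ‖z n‖ := fun n => hbig n _ (hz n).1 (hz n).2
  have hpos : ∀ n, 0 < ‖z n‖ := fun n => lt_trans (by positivity) (hlt n)
  obtain ⟨v, hv, φ, hφ, hlim⟩ := exists_subseq_tendsto_normalized hpos
  have htop : Tendsto (fun n => ‖z (φ n)‖) atTop atTop :=
    tendsto_atTop_mono (fun n => ((lt_add_one _).trans (hlt (φ n))).le)
      (tendsto_natCast_atTop_atTop.comp hφ.tendsto_atTop)
  have hinv : Tendsto (fun n => ‖z (φ n)‖⁻¹) atTop (𝓝 0) := tendsto_inv_atTop_zero.comp htop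
  have hscale : ∀ {ι : Type} [Fintype ι] (x : ℕ → ι → ℝ), (∀ n, ‖x n‖ ≤ R) →
      Tendsto (fun n => ‖z (φ n)‖⁻¹ • x (φ n)) atTop (𝓝 0) := fun x hx =>
    hinv.zero_smul_isBoundedUnder_le (isBoundedUnder_of ⟨R, fun n => hx _⟩)
  have hrec : ∀ i, 0 ≤ D.mulVec v i := by
    have : v ∈ polyhedron D 0 := mem_polyhedron_of_tendsto (hscale b hb) hlim fun n i => by
      simp only [Matrix.mulVec_smul, Pi.smul_apply, smul_eq_mul]
      exact mul_le_mul_of_nonneg_left ((hz _).1 i) (inv_nonneg.2 (norm_nonneg _))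
    exact this
  have hcurv : v ⬝ᵥ Q.mulVec v ≤ 0 := by
    have h1 := tendsto_quadObj (Q := Q) (hscale q hq) hlim
    have h2 : Tendsto (fun n => ‖z (φ n)‖⁻¹ * ‖z (φ n)‖⁻¹ * R) atTop (𝓝 (0 * 0 * R)) :=
      (hinv.mul hinv).mul_const R
    have h3 := le_of_tendsto_of_tendsto' h1 h2 fun n => by
      have h4 := (hle (φ n)).trans (hR (φ n))
      have h5 := mul_le_mul_of_nonneg_left h4 (mul_self_nonneg ‖z (φ n)‖⁻¹)
      refine le_trans (le_of_eq ?_) h5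
      simp only [quadObj, Matrix.mulVec_smul, dotProduct_smul, smul_dotProduct, smul_eq_mul]
      ring
    simp only [quadObj, zero_dotProduct] at h3
    linarith
  have hev := eventually_sub_smul_mem_polyhedron (D := D) (c := fun n => b (φ n))
    (e := fun n => ‖z (φ n)‖⁻¹ * R) (fun n => hpos (φ n)) hv hlim (fun n => (hz (φ n)).1)
    (by simpa using hinv.mul_const R) (fun n i => by
      rw [mul_right_comm, inv_mul_cancel₀ (hpos _).ne', one_mul]
      exact ((le_abs_self _).trans (norm_le_pi_norm (b (φ n)) i)).trans (hb _))
  obtain ⟨n, h1, h2⟩ := hev.exists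
  refine absurd (hmin (φ n) _ ⟨h1, ?_⟩) (not_le.2 h2)
  refine le_trans (?_ : quadObj Q _ _ ≤ _) (hle (φ n))
  rw [quadObj_add_smul hQ]
  have h3 := mul_nonneg (hpos (φ n)).le
    (slope_nonneg_of_bddBelow hQ (hbdd (φ n)) (hz (φ n)).1 hrec hcurv)
  have h4 := mul_nonneg (sq_nonneg (-(‖z (φ n)‖ / 2))) (neg_nonneg.2 hcurv)
  linarith

/-- Points of a limiting polyhedron are limits of points of the approximating polyhedra. -/
lemma exists_tendsto_mem_polyhedron {b : ℕ → Fin k → ℝ} {b₀ : Fin k → ℝ}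
    (hb : Tendsto b atTop (𝓝 b₀)) (hne : ∀ n, (polyhedron D (b n)).Nonempty)
    {z : Fin m → ℝ} (hz : z ∈ polyhedron D b₀) :
    ∃ w : ℕ → Fin m → ℝ, (∀ n, w n ∈ polyhedron D (b n)) ∧ Tendsto w atTop (𝓝 z) := by
  obtain ⟨K, hK⟩ := exists_hoffman_bound D
  have hex : ∀ n, ∃ y ∈ polyhedron D (b n - D.mulVec z), ‖y‖ ≤ K * ‖b n - b₀‖ := fun n => by
    refine hK _ _ (norm_nonneg _) (fun i => ?_) ?_
    · have h1 := (le_abs_self _).trans (norm_le_pi_norm (b n - b₀) i)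
      have h2 := hz i
      simp only [Pi.sub_apply] at h1 ⊢
      linarith
    · obtain ⟨x, hx⟩ := hne n
      exact ⟨x - z, fun i => by
        simpa only [Matrix.mulVec_sub, Pi.sub_apply, sub_le_sub_iff_right] using hx i⟩
  choose y hy hyK using hex
  refine ⟨fun n => z + y n, fun n i => ?_, ?_⟩
  · have := hy n i
    simp only [Matrix.mulVec_add, Pi.add_apply, Pi.sub_apply] at this ⊢
    linarith
  · have h0 : Tendsto y atTop (𝓝 0) := by
      refine squeeze_zero_norm hyK ?_
      simpa using (tendsto_iff_norm_sub_tendsto_zero.1 hb).const_mul K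
    simpa using h0.const_add z

lemma polyhedron_nonempty_of_tendsto {b : ℕ → Fin k → ℝ} {b₀ : Fin k → ℝ}
    (hb : Tendsto b atTop (𝓝 b₀)) (hne : ∀ n, (polyhedron D (b n)).Nonempty) :
    (polyhedron D b₀).Nonempty := by
  obtain ⟨K, hK⟩ := exists_hoffman_bound D
  choose w hw hwK using fun n => hK (b n) ‖b n‖ (norm_nonneg _)
    (fun i => (le_abs_self _).trans (norm_le_pi_norm (b n) i)) (hne n)
  obtain ⟨C, hC⟩ := (hb.norm.const_mul K).bddAbove_range
  obtain ⟨w₀, -, φ, hφ, hlim⟩ := (isCompact_closedBall (0 : Fin m → ℝ) C).tendsto_subseq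
    (x := w) fun n => by simpa using (hwK n).trans (hC ⟨n, rfl⟩)
  exact ⟨w₀, mem_polyhedron_of_tendsto (hb.comp hφ.tendsto_atTop) hlim fun n => hw (φ n)⟩

/-- Along convergent data, near-minimizers can be chosen in a fixed ball. -/
lemma exists_bounded_near_minimizers (hQ : Q.IsSymm) {q : ℕ → Fin m → ℝ} {b : ℕ → Fin k → ℝ}
    {q₀ : Fin m → ℝ} {b₀ : Fin k → ℝ} (hq : Tendsto q atTop (𝓝 q₀)) (hb : Tendsto b atTop (𝓝 b₀))
    (hne : ∀ n, (polyhedron D (b n)).Nonempty)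
    (hbdd : ∀ n, BddBelow (quadValues Q D (q n) (b n))) :
    ∃ (K : ℝ) (z : ℕ → Fin m → ℝ), ∀ n : ℕ, z n ∈ polyhedron D (b n) ∧
      z n ∈ Metric.closedBall 0 K ∧
      quadObj Q (q n) (z n) ≤ sInf (quadValues Q D (q n) (b n)) + 1 / ((n : ℝ) + 1) := by
  obtain ⟨w₀, hw₀⟩ := polyhedron_nonempty_of_tendsto hb hne
  obtain ⟨w, hw, hwlim⟩ := exists_tendsto_mem_polyhedron hb hne hw₀
  obtain ⟨A, hA⟩ := hq.norm.bddAbove_range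
  obtain ⟨B, hB⟩ := hb.norm.bddAbove_range
  obtain ⟨C, hC⟩ := (tendsto_quadObj (Q := Q) hq hwlim).bddAbove_range
  obtain ⟨K, hK⟩ := exists_bounded_point_below hQ D (max (max A B) (C + 1))
  suffices h : ∀ n : ℕ, ∃ z ∈ polyhedron D (b n), z ∈ Metric.closedBall 0 K ∧
      quadObj Q (q n) z ≤ sInf (quadValues Q D (q n) (b n)) + 1 / ((n : ℝ) + 1) by
    choose z h1 h2 using h
    exact ⟨K, z, fun n => ⟨h1 n, h2 n⟩⟩
  intro n
  have hpos : (0 : ℝ) < 1 / ((n : ℝ) + 1) := by positivity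
  have hle1 : 1 / ((n : ℝ) + 1) ≤ 1 := by
    rw [div_le_one (by positivity)]
    linarith [(Nat.cast_nonneg n : (0 : ℝ) ≤ n)]
  obtain ⟨_, ⟨x, hx, rfl⟩, hxlt⟩ := Real.lt_sInf_add_pos
    (s := quadValues Q D (q n) (b n)) ⟨_, w n, hw n, rfl⟩ hpos
  have hwx : sInf (quadValues Q D (q n) (b n)) ≤ quadObj Q (q n) (w n) :=
    csInf_le (hbdd n) ⟨w n, hw n, rfl⟩
  have hwC : quadObj Q (q n) (w n) ≤ C := hC ⟨n, rfl⟩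
  obtain ⟨z, hz, hzx, hzK⟩ := hK (q n) (b n) x
    ((hA ⟨n, rfl⟩).trans ((le_max_left _ _).trans (le_max_left _ _)))
    ((hB ⟨n, rfl⟩).trans ((le_max_right _ _).trans (le_max_left _ _)))
    (hbdd n) hx (le_max_of_le_right (by linarith))
  exact ⟨z, hz, by simpa using hzK, hzx.trans hxlt.le⟩

lemma bddBelow_quadValues_of_tendsto (hQ : Q.IsSymm) {q : ℕ → Fin m → ℝ} {b : ℕ → Fin k → ℝ}
    {q₀ : Fin m → ℝ} {b₀ : Fin k → ℝ} (hq : Tendsto q atTop (𝓝 q₀)) (hb : Tendsto b atTop (𝓝 b₀))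
    (hne : ∀ n, (polyhedron D (b n)).Nonempty)
    (hbdd : ∀ n, BddBelow (quadValues Q D (q n) (b n))) :
    BddBelow (quadValues Q D q₀ b₀) := by
  obtain ⟨K, z, hz⟩ := exists_bounded_near_minimizers hQ hq hb hne hbdd
  obtain ⟨z₀, -, φ, hφ, hlim⟩ := (isCompact_closedBall (0 : Fin m → ℝ) K).tendsto_subseq
    (x := z) fun n => (hz n).2.1
  have hφ' := hφ.tendsto_atTop
  refine ⟨quadObj Q q₀ z₀, ?_⟩
  rintro _ ⟨x, hx, rfl⟩
  obtain ⟨w, hw, hwlim⟩ := exists_tendsto_mem_polyhedron hb hne hx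
  have hright := ((tendsto_quadObj (Q := Q) hq hwlim).add
    tendsto_one_div_add_atTop_nhds_zero_nat).comp hφ'
  rw [add_zero] at hright
  exact le_of_tendsto_of_tendsto' (tendsto_quadObj (hq.comp hφ') hlim) hright fun n =>
    (hz (φ n)).2.2.trans (add_le_add_left (csInf_le (hbdd _) ⟨_, hw _, rfl⟩) _)

lemma tendsto_sInf_quadValues (hQ : Q.IsSymm) {q : ℕ → Fin m → ℝ} {b : ℕ → Fin k → ℝ}
    {q₀ : Fin m → ℝ} {b₀ : Fin k → ℝ} (hq : Tendsto q atTop (𝓝 q₀)) (hb : Tendsto b atTop (𝓝 b₀))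
    (hne : ∀ n, (polyhedron D (b n)).Nonempty)
    (hbdd : ∀ n, BddBelow (quadValues Q D (q n) (b n))) :
    Tendsto (fun n => sInf (quadValues Q D (q n) (b n))) atTop
      (𝓝 (sInf (quadValues Q D q₀ b₀))) := by
  refine tendsto_order.2 ⟨fun a ha => ?_, fun a ha => ?_⟩
  · by_contra hcon
    obtain ⟨φ, hφ, hle⟩ := extraction_of_frequently_atTop (not_eventually.1 hcon)
    have hφ' := hφ.tendsto_atTop
    obtain ⟨K, z, hz⟩ := exists_bounded_near_minimizers hQ hq hb hne hbdd
    obtain ⟨z₀, -, ψ, hψ, hlim⟩ := (isCompact_closedBall (0 : Fin m → ℝ) K).tendsto_subseq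
      (x := z ∘ φ) fun n => (hz (φ n)).2.1
    have hφψ := hφ'.comp hψ.tendsto_atTop
    have hz₀ : z₀ ∈ polyhedron D b₀ :=
      mem_polyhedron_of_tendsto (hb.comp hφψ) hlim fun n => (hz _).1
    have hright := (tendsto_one_div_add_atTop_nhds_zero_nat (𝕜 := ℝ)).const_add a |>.comp hφψ
    rw [add_zero] at hright
    have h1 : quadObj Q q₀ z₀ ≤ a :=
      le_of_tendsto_of_tendsto' (tendsto_quadObj (hq.comp hφψ) hlim) hright fun n =>
        (hz (φ (ψ n))).2.2.trans (add_le_add_left (not_lt.1 (hle (ψ n))) _)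
    have h2 : sInf (quadValues Q D q₀ b₀) ≤ quadObj Q q₀ z₀ :=
      csInf_le (bddBelow_quadValues_of_tendsto hQ hq hb hne hbdd) ⟨z₀, hz₀, rfl⟩
    linarith
  · obtain ⟨x₀, hx₀⟩ := polyhedron_nonempty_of_tendsto hb hne
    obtain ⟨_, ⟨x, hx, rfl⟩, hxlt⟩ := exists_lt_of_csInf_lt
      (s := quadValues Q D q₀ b₀) ⟨_, x₀, hx₀, rfl⟩ ha
    obtain ⟨w, hw, hwlim⟩ := exists_tendsto_mem_polyhedron hb hne hx
    filter_upwards [(tendsto_quadObj (Q := Q) hq hwlim).eventually_lt_const hxlt] with n hn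
    exact (csInf_le (hbdd n) ⟨_, hw n, rfl⟩).trans_lt hn

end

theorem qp_value_continuous_on_domain (m k : ℕ)
    (Q : Matrix (Fin m) (Fin m) ℝ) (hQsym : Q.IsSymm)
    (D : Matrix (Fin k) (Fin m) ℝ)
    (hcop : ∀ v : Fin m → ℝ, (∀ i, 0 ≤ D.mulVec v i) → 0 ≤ v ⬝ᵥ Q.mulVec v)
    (qpopt : (Fin m → ℝ) × (Fin k → ℝ) → ℝ)
    (hqpopt : ∀ qb : (Fin m → ℝ) × (Fin k → ℝ),
      qpopt qb = sInf {r | ∃ z : Fin m → ℝ,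
        (∀ i, qb.2 i ≤ D.mulVec z i) ∧
          r = qb.1 ⬝ᵥ z + (1 / 2) * z ⬝ᵥ Q.mulVec z})
    (dom : Set ((Fin m → ℝ) × (Fin k → ℝ)))
    (hdom : dom = {qb | ({z : Fin m → ℝ | ∀ i, qb.2 i ≤ D.mulVec z i}).Nonempty ∧
      BddBelow {r | ∃ z : Fin m → ℝ,
        (∀ i, qb.2 i ≤ D.mulVec z i) ∧
          r = qb.1 ⬝ᵥ z + (1 / 2) * z ⬝ᵥ Q.mulVec z}}) :
    ContinuousOn qpopt dom ∧
    (∀ (u : ℕ → (Fin m → ℝ) × (Fin k → ℝ)) (l : (Fin m → ℝ) × (Fin k → ℝ)),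
      (∀ ν, u ν ∈ dom) → Filter.Tendsto u Filter.atTop (nhds l) →
        l ∈ dom ∧
          Filter.Tendsto (fun ν => qpopt (u ν)) Filter.atTop (nhds (qpopt l))) := by
  have hseq : ∀ (u : ℕ → (Fin m → ℝ) × (Fin k → ℝ)) (l : (Fin m → ℝ) × (Fin k → ℝ)),
      (∀ ν, u ν ∈ dom) → Tendsto u atTop (𝓝 l) →
        l ∈ dom ∧ Tendsto (fun ν => qpopt (u ν)) atTop (𝓝 (qpopt l)) := by
    intro u l hu hl
    rw [hdom] at hu ⊢
    have hq := (continuous_fst.tendsto l).comp hl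
    have hb := (continuous_snd.tendsto l).comp hl
    simp only [hqpopt]
    exact ⟨⟨polyhedron_nonempty_of_tendsto hb fun n => (hu n).1,
      bddBelow_quadValues_of_tendsto hQsym hq hb (fun n => (hu n).1) fun n => (hu n).2⟩,
      tendsto_sInf_quadValues hQsym hq hb (fun n => (hu n).1) fun n => (hu n).2⟩
  refine ⟨?_, hseq⟩
  rw [continuousOn_iff_continuous_domRestrict]
  refine SeqContinuous.continuous fun x p hx => ?_
  exact (hseq (fun n => x n) p (fun n => (x n).2)
    ((continuous_subtype_val.tendsto p).comp hx)).2
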